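/- arXiv:0908.1995 — 6 statements merged into one kernel-verified Lean document; each statement's English description precedes it below -/
import Mathlib

section
/- Let m be a positive integer. For an integer x write x' for the remainder of x upon division by m, and define g(a,b) := a·(b − b') for integers a,b. Then for all integers i,j,k one has g(j,k) − g(i+j,k) + g(i,j+k) − g(i,j) ≡ i'·(j' + k' − (j+k)') (mod m²). -/
/-- For a positive integer `m`, define `g a b = a * (b - b % m)`. Then the coboundary of `g`
is congruent modulo `m ^ 2` to the 3-cocycle `(i % m) * (j % m + k % m - (j + k) % m)`. -/
theorem stmt1 (m : ℕ) (hm : 0 < m)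
    (g : ℤ → ℤ → ℤ)
    (hg : ∀ a b : ℤ, g a b = a * (b - b % (m : ℤ))) :
    ∀ i j k : ℤ,
      ((m : ℤ) ^ 2) ∣
        (g j k - g (i + j) k + g i (j + k) - g i j
          - (i % (m : ℤ)) * (j % (m : ℤ) + k % (m : ℤ) - (j + k) % (m : ℤ))) := by
  intro i j k
  have hi : (m : ℤ) ∣ i - i % m := Int.dvd_self_sub_emod
  have hjk : (m : ℤ) ∣ j % m + k % m - (j + k) % m :=
    Int.ModEq.dvd (((Int.mod_modEq j m).add (Int.mod_modEq k m)).trans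
      (Int.mod_modEq (j + k) m).symm).symm
  have key : g j k - g (i + j) k + g i (j + k) - g i j
      - i % m * (j % m + k % m - (j + k) % m)
      = (i - i % m) * (j % m + k % m - (j + k) % m) := by
    simp only [hg]
    ring
  rw [key, sq]
  exact mul_dvd_mul hi hjk
end

section
/- Let p be an odd prime, n ≥ 1 an integer, and κ ∈ {1,2,3} with p not dividing κ. Let a₁, a₂, c₁, c₂ be integers coprime to p and α₁, α₂, γ₁, γ₂ nonnegative integers with α₁ + γ₁ < n and α₂ + γ₂ < n. Suppose p^{α₁+γ₁}·a₁c₁ ≡ κ·p^{α₂+γ₂}·a₂c₂ (mod p^n) and κ·p^{α₂+γ₂}·a₂c₂ ≡ −(p^{α₁+γ₂}·a₁c₂ + p^{α₂+γ₁}·a₂c₁) (mod p^n). Then α₁ = α₂, γ₁ = γ₂, and, setting m := α₁ + γ₁, p^{n−m} divides κ·(a₁c₂)² + κ·(a₁c₁)·(a₁c₂) + (a₁c₁)². -/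
/-- If `q ^ i * u + v` is divisible by `q ^ (i + 1)`, and so is `v`, then `q` divides `u`. -/
theorem dvd_of_pow_succ_dvd_add {q u v : ℤ} {i : ℕ} (hq : q ≠ 0)
    (h : q ^ (i + 1) ∣ q ^ i * u + v) (hv : q ^ (i + 1) ∣ v) : q ∣ u := by
  have h' : q ^ i * q ∣ q ^ i * u := by
    rw [← pow_succ]
    exact (dvd_add_left hv).mp h
  exact (mul_dvd_mul_iff_left (pow_ne_zero i hq)).mp h'

/-- If `q ^ i * u + q ^ j * v` is divisible by a power `q ^ n` with `i < n`, and `q` does not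
divide `u`, then `j ≤ i`. -/
theorem le_of_pow_dvd_add {q u v : ℤ} {i j n : ℕ} (hq : q ≠ 0) (hu : ¬ q ∣ u) (hi : i < n)
    (h : q ^ n ∣ q ^ i * u + q ^ j * v) : j ≤ i := by
  by_contra! hij
  exact hu (dvd_of_pow_succ_dvd_add hq ((pow_dvd_pow q hi).trans h)
    ((pow_dvd_pow q hij).mul_right v))

/-- Cartan type `X₂` over `ℤ/pⁿ` (`κ = 1, 2, 3` for `A₂`, `B₂`, `G₂`): the Cartan conditions
force the `p`-adic valuations to match and reduce to a quadratic congruence. -/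
theorem stmt8 (p : ℕ) (hp : p.Prime) (hodd : Odd p) (n : ℕ) (hn : 1 ≤ n)
    (κ : ℤ) (hκ : κ = 1 ∨ κ = 2 ∨ κ = 3) (hpκ : ¬ (p : ℤ) ∣ κ)
    (a₁ a₂ c₁ c₂ : ℤ)
    (ha₁ : ¬ (p : ℤ) ∣ a₁) (ha₂ : ¬ (p : ℤ) ∣ a₂)
    (hc₁ : ¬ (p : ℤ) ∣ c₁) (hc₂ : ¬ (p : ℤ) ∣ c₂)
    (α₁ α₂ γ₁ γ₂ : ℕ) (h₁ : α₁ + γ₁ < n) (h₂ : α₂ + γ₂ < n)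
    (hcong1 : (p : ℤ) ^ (α₁ + γ₁) * (a₁ * c₁) ≡
      κ * ((p : ℤ) ^ (α₂ + γ₂) * (a₂ * c₂)) [ZMOD (p : ℤ) ^ n])
    (hcong2 : κ * ((p : ℤ) ^ (α₂ + γ₂) * (a₂ * c₂)) ≡
      -((p : ℤ) ^ (α₁ + γ₂) * (a₁ * c₂) + (p : ℤ) ^ (α₂ + γ₁) * (a₂ * c₁))
        [ZMOD (p : ℤ) ^ n]) :
    α₁ = α₂ ∧ γ₁ = γ₂ ∧
      ((p : ℤ) ^ (n - (α₁ + γ₁))) ∣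
        (κ * (a₁ * c₂) ^ 2 + κ * (a₁ * c₁) * (a₁ * c₂) + (a₁ * c₁) ^ 2) := by
  have hq : Prime (p : ℤ) := Nat.prime_iff_prime_int.mp hp
  generalize (p : ℤ) = q at *
  have hq0 : q ≠ 0 := hq.ne_zero
  have d₁ := hcong1.symm.dvd
  have d₂ := hcong2.symm.dvd
  have hle : α₂ + γ₂ ≤ α₁ + γ₁ :=
    le_of_pow_dvd_add (v := -(κ * (a₂ * c₂))) hq0 (hq.not_dvd_mul ha₁ hc₁) h₁
      (by convert d₁ using 1; ring)
  have hge : α₁ + γ₁ ≤ α₂ + γ₂ :=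
    le_of_pow_dvd_add (v := -(a₁ * c₁)) hq0
      (hq.not_dvd_mul hpκ (hq.not_dvd_mul ha₂ hc₂)) h₂
      (by convert hcong1.dvd using 1; ring)
  have hm : α₂ + γ₂ = α₁ + γ₁ := le_antisymm hle hge
  rw [hm] at d₁ d₂
  have e₂ : q ^ (α₁ + γ₁) ∣
      q ^ (α₁ + γ₂) * (a₁ * c₂) + q ^ (α₂ + γ₁) * (a₂ * c₁) := by
    refine (dvd_add_right (a := q ^ (α₁ + γ₁)) (b := q ^ (α₁ + γ₁) * (κ * (a₂ * c₂)))
      (dvd_mul_right _ _)).mp ?_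
    convert (pow_dvd_pow q h₁.le).trans d₂ using 1
    ring
  have hγ : γ₁ = γ₂ := by
    rcases lt_trichotomy γ₁ γ₂ with h | h | h
    · have := le_of_pow_dvd_add hq0 (hq.not_dvd_mul ha₂ hc₁) (by omega)
        ((add_comm _ _).subst e₂)
      omega
    · exact h
    · have := le_of_pow_dvd_add hq0 (hq.not_dvd_mul ha₁ hc₂) (by omega) e₂
      omega
  have hα : α₁ = α₂ := by omega
  subst hγ hα
  refine ⟨rfl, rfl, ?_⟩
  have cancel {x : ℤ} (h : q ^ n ∣ q ^ (α₁ + γ₁) * x) : q ^ (n - (α₁ + γ₁)) ∣ x := by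
    rw [← Nat.add_sub_of_le h₁.le, pow_add] at h
    exact (mul_dvd_mul_iff_left (pow_ne_zero _ hq0)).mp h
  have f₁ : q ^ (n - (α₁ + γ₁)) ∣ a₁ * c₁ - κ * (a₂ * c₂) :=
    cancel (by convert d₁ using 1; ring)
  have f₂ : q ^ (n - (α₁ + γ₁)) ∣ κ * (a₂ * c₂) + (a₁ * c₂ + a₂ * c₁) :=
    cancel (by convert d₂ using 1; ring)
  have key : κ * (a₁ * c₂) ^ 2 + κ * (a₁ * c₁) * (a₁ * c₂) + (a₁ * c₁) ^ 2 =
      (a₁ * c₁ - κ * (a₂ * c₂)) * (a₁ * c₁ + κ * (a₁ * c₂)) +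
        (κ * (a₂ * c₂) + (a₁ * c₂ + a₂ * c₁)) * (κ * (a₁ * c₂)) := by
    ring
  rw [key]
  exact dvd_add (f₁.mul_right _) (f₂.mul_right _)
end

section
/- Let p be an odd prime, n ≥ 1 an integer, and let a₁, a₂, c₁, c₂ be integers coprime to p and α₁, α₂, γ₁, γ₂ nonnegative integers with α₁ + γ₁ < n and α₂ + γ₂ < n. If p^{α₁+γ₁}·a₁c₁ ≡ p^{α₂+γ₂}·a₂c₂ (mod p^n) and p^{α₂+γ₂}·a₂c₂ ≡ −(p^{α₁+γ₂}·a₁c₂ + p^{α₂+γ₁}·a₂c₁) (mod p^n), then either p ≡ 1 (mod 3), or p = 3 and α₁ + γ₁ = n − 1. -/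
/-- If `p ^ i * u` is congruent modulo `p ^ n`, with `n > i`, to a multiple of `p ^ j`, with
`j > i`, then `p ∣ u`. -/
theorem Int.dvd_of_pow_mul_modEq {p u v : ℤ} (hp : p ≠ 0) {i j n : ℕ} (hij : i < j) (hin : i < n)
    (h : p ^ i * u ≡ p ^ j * v [ZMOD p ^ n]) : p ∣ u := by
  have hmod := h.of_dvd (pow_dvd_pow p (Nat.succ_le_of_lt hin))
  have hdvd : p ^ (i + 1) ∣ p ^ i * u :=
    hmod.dvd_iff.2 ((pow_dvd_pow p (Nat.succ_le_of_lt hij)).mul_right v)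
  rw [pow_succ] at hdvd
  exact (mul_dvd_mul_iff_left (pow_ne_zero i hp)).1 hdvd

/-- A prime dividing `x² + xy + y²` but neither `x` nor `y` is not `2` modulo `3`. -/
theorem Nat.Prime.mod_three_ne_two_of_dvd_sq_add_mul_add_sq {p : ℕ} (hp : p.Prime) {x y : ℤ}
    (hx : ¬ (p : ℤ) ∣ x) (hy : ¬ (p : ℤ) ∣ y) (h : (p : ℤ) ∣ x ^ 2 + x * y + y ^ 2) :
    p % 3 ≠ 2 := by
  intro hmod
  have : Fact p.Prime := ⟨hp⟩
  rw [← ZMod.intCast_zmod_eq_zero_iff_dvd] at hx hy h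
  push_cast at h
  generalize (x : ZMod p) = X at *
  generalize (y : ZMod p) = Y at *
  have hcube : X ^ 3 = Y ^ 3 := by linear_combination (X - Y) * h
  obtain ⟨k, hk⟩ : ∃ k, p - 1 = 3 * k + 1 := ⟨p / 3, by omega⟩
  have hX := ZMod.pow_card_sub_one_eq_one hx
  have hY := ZMod.pow_card_sub_one_eq_one hy
  rw [hk, pow_succ, pow_mul] at hX hY
  rw [hcube, ← hY] at hX
  have hXY : X = Y := mul_left_cancel₀ (pow_ne_zero k (pow_ne_zero 3 hy)) hX
  subst hXY
  have hthree : (3 : ZMod p) * X ^ 2 = 0 := by linear_combination h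
  have hzero : ((3 : ℕ) : ZMod p) = 0 := by
    simpa [hx] using hthree
  rw [ZMod.natCast_eq_zero_iff, Nat.prime_dvd_prime_iff_eq hp Nat.prime_three] at hzero
  omega

/-- The form `x² + xy + y²` vanishes modulo `9` only if `3 ∣ x`. -/
theorem Int.three_dvd_of_nine_dvd_sq_add_mul_add_sq {x y : ℤ} (h : 9 ∣ x ^ 2 + x * y + y ^ 2) :
    3 ∣ x := by
  have key : ∀ X Y : ZMod 9, X ^ 2 + X * Y + Y ^ 2 = 0 → 3 * X = 0 := by decide
  have hxy : ((x ^ 2 + x * y + y ^ 2 : ℤ) : ZMod 9) = 0 :=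
    (ZMod.intCast_zmod_eq_zero_iff_dvd _ 9).2 h
  have hx : ((3 * x : ℤ) : ZMod 9) = 0 := by
    push_cast at hxy ⊢
    exact key _ _ hxy
  rw [ZMod.intCast_zmod_eq_zero_iff_dvd] at hx
  omega

/-- Cartan type `A₂` over `ℤ/pⁿ`: the `A₂` conditions force `p ≡ 1 (mod 3)`, or `p = 3`
and `α₁ + γ₁ = n - 1`. -/
theorem stmt9 (p : ℕ) (hp : p.Prime) (hodd : Odd p) (n : ℕ) (hn : 1 ≤ n)
    (a₁ a₂ c₁ c₂ : ℤ)
    (ha₁ : ¬ (p : ℤ) ∣ a₁) (ha₂ : ¬ (p : ℤ) ∣ a₂)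
    (hc₁ : ¬ (p : ℤ) ∣ c₁) (hc₂ : ¬ (p : ℤ) ∣ c₂)
    (α₁ α₂ γ₁ γ₂ : ℕ) (h₁ : α₁ + γ₁ < n) (h₂ : α₂ + γ₂ < n)
    (hcong1 : (p : ℤ) ^ (α₁ + γ₁) * (a₁ * c₁) ≡
      (p : ℤ) ^ (α₂ + γ₂) * (a₂ * c₂) [ZMOD (p : ℤ) ^ n])
    (hcong2 : (p : ℤ) ^ (α₂ + γ₂) * (a₂ * c₂) ≡
      -((p : ℤ) ^ (α₁ + γ₂) * (a₁ * c₂) + (p : ℤ) ^ (α₂ + γ₁) * (a₂ * c₁))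
        [ZMOD (p : ℤ) ^ n]) :
    p % 3 = 1 ∨ (p = 3 ∧ α₁ + γ₁ = n - 1) := by
  have hpi : Prime (p : ℤ) := Nat.prime_iff_prime_int.1 hp
  have hp0 : (p : ℤ) ≠ 0 := hpi.ne_zero
  have hm : α₁ + γ₁ = α₂ + γ₂ := by
    rcases lt_trichotomy (α₁ + γ₁) (α₂ + γ₂) with h | h | h
    · exact absurd (Int.dvd_of_pow_mul_modEq hp0 h h₁ hcong1) (hpi.not_dvd_mul ha₁ hc₁)
    · exact h
    · exact absurd (Int.dvd_of_pow_mul_modEq hp0 h h₂ hcong1.symm) (hpi.not_dvd_mul ha₂ hc₂)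
  have hα : α₁ = α₂ := by
    rcases lt_trichotomy α₁ α₂ with h | h | h
    · obtain ⟨d, rfl⟩ := Nat.exists_eq_add_of_lt h
      obtain rfl : γ₁ = γ₂ + d + 1 := by omega
      refine absurd (Int.dvd_of_pow_mul_modEq (i := α₁ + γ₂) (j := α₁ + γ₂ + 1) (n := n)
        (v := -(p ^ d * (a₂ * c₂) + p ^ (2 * d + 1) * (a₂ * c₁))) hp0 (by omega) (by omega) ?_)
        (hpi.not_dvd_mul ha₁ hc₂)
      rw [Int.modEq_iff_dvd] at hcong2 ⊢
      convert hcong2 using 1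
      ring
    · exact h
    · obtain ⟨d, rfl⟩ := Nat.exists_eq_add_of_lt h
      obtain rfl : γ₂ = γ₁ + d + 1 := by omega
      refine absurd (Int.dvd_of_pow_mul_modEq (i := α₂ + γ₁) (j := α₂ + γ₁ + 1) (n := n)
        (v := -(p ^ d * (a₂ * c₂) + p ^ (2 * d + 1) * (a₁ * c₂))) hp0 (by omega) (by omega) ?_)
        (hpi.not_dvd_mul ha₂ hc₁)
      rw [Int.modEq_iff_dvd] at hcong2 ⊢
      convert hcong2 using 1
      ring
  subst hα
  obtain rfl : γ₁ = γ₂ := by omega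
  obtain ⟨k, rfl⟩ := Nat.exists_eq_add_of_lt h₁
  rw [add_assoc _ k, pow_add _ (α₁ + γ₁) (k + 1)] at hcong1 hcong2
  rw [← mul_add, ← mul_neg] at hcong2
  rw [Int.modEq_iff_dvd, ← mul_sub, mul_dvd_mul_iff_left (pow_ne_zero _ hp0)] at hcong1 hcong2
  have hform : (p : ℤ) ^ (k + 1) ∣ a₁ ^ 2 + a₁ * a₂ + a₂ ^ 2 := by
    refine hpi.pow_dvd_of_dvd_mul_right _ hc₂ ?_
    obtain ⟨s, hs⟩ := hcong1
    obtain ⟨t, ht⟩ := hcong2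
    exact ⟨a₂ * s - a₁ * t, by linear_combination a₂ * hs - a₁ * ht⟩
  have hmod := hp.mod_three_ne_two_of_dvd_sq_add_mul_add_sq ha₁ ha₂
    ((dvd_pow_self _ k.succ_ne_zero).trans hform)
  by_cases h3 : p = 3
  · subst h3
    refine Or.inr ⟨rfl, ?_⟩
    by_contra hk
    have hnine : (9 : ℤ) ∣ (3 : ℕ) ^ (k + 1) := by
      simpa using pow_dvd_pow (3 : ℤ) (show 2 ≤ k + 1 by omega)
    exact ha₁ (Int.three_dvd_of_nine_dvd_sq_add_mul_add_sq (hnine.trans hform))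
  · have hndvd : ¬ 3 ∣ p := fun h =>
      h3 ((Nat.prime_dvd_prime_iff_eq Nat.prime_three hp).1 h).symm
    omega
end

section
/- Let p be an odd prime, n ≥ 1 an integer, and let a₁, a₂, c₁, c₂ be integers coprime to p and α₁, α₂, γ₁, γ₂ nonnegative integers with α₁ + γ₁ < n and α₂ + γ₂ < n. If p^{α₁+γ₁}·a₁c₁ ≡ 2·p^{α₂+γ₂}·a₂c₂ (mod p^n) and 2·p^{α₂+γ₂}·a₂c₂ ≡ −(p^{α₁+γ₂}·a₁c₂ + p^{α₂+γ₁}·a₂c₁) (mod p^n), then p ≡ 1 (mod 4). -/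
/-- An integer `x` coprime to `p` does not satisfy `p ^ j ∣ p ^ i * x` when `i < j`. -/
theorem not_pow_dvd_pow_mul {p x : ℤ} (hp : p ≠ 0) (hx : ¬ p ∣ x) {i j : ℕ} (hij : i < j) :
    ¬ p ^ j ∣ p ^ i * x := by
  intro h
  have h' : p ^ i * p ∣ p ^ i * x := by
    rw [← pow_succ]
    exact (pow_dvd_pow p hij).trans h
  exact hx ((mul_dvd_mul_iff_left (pow_ne_zero i hp)).1 h')

/-- If `a₁ c₁ = 2 a₂ c₂ = -(a₁ c₂ + a₂ c₁)` in a field with `a₂, c₂ ≠ 0`,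
then `-1` is a square. -/
theorem isSquare_neg_one_of_mul_eq {K : Type*} [Field K] {a₁ a₂ c₁ c₂ : K}
    (ha₂ : a₂ ≠ 0) (hc₂ : c₂ ≠ 0) (h₁ : a₁ * c₁ = 2 * (a₂ * c₂))
    (h₂ : 2 * (a₂ * c₂) = -(a₁ * c₂ + a₂ * c₁)) : IsSquare (-1 : K) := by
  have key : (a₁ + a₂) * (a₁ + a₂) = -(a₂ * a₂) := by
    apply mul_right_cancel₀ hc₂
    linear_combination a₁ * h₂ - a₂ * h₁
  refine ⟨(a₁ + a₂) / a₂, ?_⟩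
  rw [div_mul_div_comm, key, neg_div, div_self (mul_ne_zero ha₂ ha₂)]

/-- Cartan type `B₂` over `ℤ/pⁿ`: the `B₂` conditions force `p ≡ 1 (mod 4)`. -/
theorem stmt10 (p : ℕ) (hp : p.Prime) (hodd : Odd p) (n : ℕ) (hn : 1 ≤ n)
    (a₁ a₂ c₁ c₂ : ℤ)
    (ha₁ : ¬ (p : ℤ) ∣ a₁) (ha₂ : ¬ (p : ℤ) ∣ a₂)
    (hc₁ : ¬ (p : ℤ) ∣ c₁) (hc₂ : ¬ (p : ℤ) ∣ c₂)
    (α₁ α₂ γ₁ γ₂ : ℕ) (h₁ : α₁ + γ₁ < n) (h₂ : α₂ + γ₂ < n)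
    (hcong1 : (p : ℤ) ^ (α₁ + γ₁) * (a₁ * c₁) ≡
      2 * ((p : ℤ) ^ (α₂ + γ₂) * (a₂ * c₂)) [ZMOD (p : ℤ) ^ n])
    (hcong2 : 2 * ((p : ℤ) ^ (α₂ + γ₂) * (a₂ * c₂)) ≡
      -((p : ℤ) ^ (α₁ + γ₂) * (a₁ * c₂) + (p : ℤ) ^ (α₂ + γ₁) * (a₂ * c₁))
        [ZMOD (p : ℤ) ^ n]) :
    p % 4 = 1 := by
  have hp0 : (p : ℤ) ≠ 0 := by exact_mod_cast hp.ne_zero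
  have hpp : Prime (p : ℤ) := Nat.prime_iff_prime_int.1 hp
  have h2 : ¬ (p : ℤ) ∣ 2 := by
    intro h
    have h' : p ∣ 2 := by exact_mod_cast h
    rw [(Nat.prime_dvd_prime_iff_eq hp Nat.prime_two).1 h'] at hodd
    exact absurd hodd (by decide)
  have hac : ∀ {x y : ℤ}, ¬ (p : ℤ) ∣ x → ¬ (p : ℤ) ∣ y → ¬ (p : ℤ) ∣ x * y :=
    fun hx hy h => (hpp.dvd_or_dvd h).elim hx hy
  have hd1 := hcong1.symm.dvd
  have hd2 := hcong2.symm.dvd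
  have hs : α₁ + γ₁ = α₂ + γ₂ := by
    rcases lt_trichotomy (α₁ + γ₁) (α₂ + γ₂) with h | h | h
    · refine absurd ?_ (not_pow_dvd_pow_mul hp0 (hac ha₁ hc₁) h)
      have e := (pow_dvd_pow (p : ℤ) h₂.le).trans hd1
      exact (dvd_sub_left ((dvd_mul_right _ _).mul_left 2)).1 e
    · exact h
    · refine absurd ?_ (not_pow_dvd_pow_mul hp0 (hac h2 (hac ha₂ hc₂)) h)
      have e := (pow_dvd_pow (p : ℤ) h₁.le).trans hd1
      rw [mul_left_comm]
      exact (dvd_sub_right (dvd_mul_right _ _)).1 e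
  have hu : α₁ + γ₂ = α₂ + γ₂ := by
    rcases lt_trichotomy (α₁ + γ₂) (α₂ + γ₂) with h | h | h
    · refine absurd ?_ (not_pow_dvd_pow_mul hp0 (hac ha₁ hc₂) h)
      have e := (pow_dvd_pow (p : ℤ) h₂.le).trans hd2
      have e1 : (p : ℤ) ^ (α₂ + γ₂) ∣ 2 * ((p : ℤ) ^ (α₂ + γ₂) * (a₂ * c₂)) :=
        (dvd_mul_right _ _).mul_left 2
      have e2 : (p : ℤ) ^ (α₂ + γ₂) ∣ (p : ℤ) ^ (α₂ + γ₁) * (a₂ * c₁) :=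
        (pow_dvd_pow _ (by omega)).mul_right _
      exact (dvd_add_left e2).1 (dvd_neg.1 ((dvd_sub_right e1).1 e))
    · exact h
    · refine absurd ?_ (not_pow_dvd_pow_mul hp0 (hac ha₂ hc₁)
        (show α₂ + γ₁ < α₂ + γ₂ by omega))
      have e := (pow_dvd_pow (p : ℤ) h₂.le).trans hd2
      have e1 : (p : ℤ) ^ (α₂ + γ₂) ∣ 2 * ((p : ℤ) ^ (α₂ + γ₂) * (a₂ * c₂)) :=
        (dvd_mul_right _ _).mul_left 2
      have e2 : (p : ℤ) ^ (α₂ + γ₂) ∣ (p : ℤ) ^ (α₁ + γ₂) * (a₁ * c₂) :=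
        (pow_dvd_pow _ h.le).mul_right _
      exact (dvd_add_right e2).1 (dvd_neg.1 ((dvd_sub_right e1).1 e))
  have hv : α₂ + γ₁ = α₂ + γ₂ := by omega
  rw [hs] at hd1
  rw [hu, hv] at hd2
  have hq1 : (p : ℤ) ∣ a₁ * c₁ - 2 * (a₂ * c₂) := by
    by_contra hx
    refine not_pow_dvd_pow_mul hp0 hx h₂ ?_
    convert hd1 using 1
    ring
  have hq2 : (p : ℤ) ∣ 2 * (a₂ * c₂) - -(a₁ * c₂ + a₂ * c₁) := by
    by_contra hx
    refine not_pow_dvd_pow_mul hp0 hx h₂ ?_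
    convert hd2 using 1
    ring
  have : Fact p.Prime := ⟨hp⟩
  have hz : ∀ x : ℤ, ¬ (p : ℤ) ∣ x → (x : ZMod p) ≠ 0 :=
    fun x hx h => hx ((ZMod.intCast_zmod_eq_zero_iff_dvd x p).1 h)
  have z1 := (ZMod.intCast_zmod_eq_zero_iff_dvd _ p).2 hq1
  have z2 := (ZMod.intCast_zmod_eq_zero_iff_dvd _ p).2 hq2
  push_cast at z1 z2
  have hsq := isSquare_neg_one_of_mul_eq (hz _ ha₂) (hz _ hc₂)
    (sub_eq_zero.1 z1) (sub_eq_zero.1 z2)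
  have h3 := ZMod.exists_sq_eq_neg_one_iff.1 hsq
  have := Nat.odd_iff.1 hodd
  omega
end

section
/- Let p be a prime with p ≠ 2 and p ≠ 3, n ≥ 1 an integer, and let a₁, a₂, c₁, c₂ be integers coprime to p and α₁, α₂, γ₁, γ₂ nonnegative integers with α₁ + γ₁ < n and α₂ + γ₂ < n. If p^{α₁+γ₁}·a₁c₁ ≡ 3·p^{α₂+γ₂}·a₂c₂ (mod p^n) and 3·p^{α₂+γ₂}·a₂c₂ ≡ −(p^{α₁+γ₂}·a₁c₂ + p^{α₂+γ₁}·a₂c₁) (mod p^n), then p ≡ 1 (mod 3). -/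
/-- If `pⁱu ≡ pʲv (mod pⁿ)` with `i < n` and `p ∤ u`, then `j ≤ i`. -/
theorem exponent_le_of_pow_mul_modEq {p u v : ℤ} {i j n : ℕ} (hp : p ≠ 0) (hu : ¬ p ∣ u)
    (hi : i < n) (h : p ^ i * u ≡ p ^ j * v [ZMOD p ^ n]) : j ≤ i := by
  by_contra! hij
  have hn : p ^ (i + 1) ∣ p ^ j * v - p ^ i * u := (pow_dvd_pow p hi).trans h.dvd
  have hj : p ^ (i + 1) ∣ p ^ j * v := (pow_dvd_pow p hij).mul_right v
  have hd : p ^ i * p ∣ p ^ i * u := by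
    rw [← pow_succ]
    exact (dvd_sub_right hj).mp hn
  exact hu ((mul_dvd_mul_iff_left (pow_ne_zero i hp)).mp hd)

/-- A congruence modulo `pⁿ` between multiples of `pⁱ`, `i < n`, may be divided by `pⁱ` to give a
congruence modulo `p`. -/
theorem modEq_of_pow_mul_modEq {p u v : ℤ} {i n : ℕ} (hp : p ≠ 0) (hi : i < n)
    (h : p ^ i * u ≡ p ^ i * v [ZMOD p ^ n]) : u ≡ v [ZMOD p] := by
  have hd : p ^ i * p ∣ p ^ i * (v - u) := by
    rw [← pow_succ, mul_sub]
    exact (pow_dvd_pow p hi).trans h.dvd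
  exact Int.modEq_iff_dvd.mpr ((mul_dvd_mul_iff_left (pow_ne_zero i hp)).mp hd)

/-- If `pᵏu + pˡv ≡ pˢw (mod pⁿ)` with `k < l`, `k < n` and `p ∤ u`, then `s ≤ k`. -/
theorem exponent_le_of_add_modEq {p u v w : ℤ} {k l s n : ℕ} (hp : p ≠ 0) (hu : ¬ p ∣ u)
    (hk : k < n) (hkl : k < l) (h : p ^ k * u + p ^ l * v ≡ p ^ s * w [ZMOD p ^ n]) :
    s ≤ k := by
  obtain ⟨m, rfl⟩ := Nat.exists_eq_add_of_lt hkl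
  have hu' : ¬ p ∣ u + p * (p ^ m * v) := by
    rwa [dvd_add_left (dvd_mul_right p _)]
  refine exponent_le_of_pow_mul_modEq (v := w) hp hu' hk ?_
  convert h using 1
  ring

/-- A prime `p ≠ 3` for which `X² + X + 1` has a root in `ZMod p` is `1` modulo `3`. -/
theorem mod_three_eq_one_of_root {p : ℕ} [Fact p.Prime] (hp3 : p ≠ 3) (w : ZMod p)
    (hw : w ^ 2 + w + 1 = 0) : p % 3 = 1 := by
  have h3 : (3 : ZMod p) ≠ 0 := by
    intro h
    have hd : p ∣ 3 := (ZMod.natCast_eq_zero_iff 3 p).mp (by exact_mod_cast h)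
    exact hp3 ((Nat.prime_dvd_prime_iff_eq Fact.out Nat.prime_three).mp hd)
  have hw1 : w ≠ 1 := by
    rintro rfl
    exact h3 (by linear_combination hw)
  have hw3 : w ^ 3 = 1 := by linear_combination (w - 1) * hw
  have hw0 : w ≠ 0 := by
    rintro rfl
    simp at hw
  have hd : 3 ∣ p - 1 := by
    rw [← orderOf_eq_prime hw3 hw1]
    exact orderOf_dvd_of_pow_eq_one (ZMod.pow_card_sub_one_eq_one hw0)
  have := (Fact.out : p.Prime).two_le
  omega

/-- Cartan type `G₂` over `ℤ/pⁿ`, `p ≠ 2, 3`: the `G₂` conditions force `p ≡ 1 (mod 3)`. -/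
theorem stmt11 (p : ℕ) (hp : p.Prime) (hp2 : p ≠ 2) (hp3 : p ≠ 3) (n : ℕ) (hn : 1 ≤ n)
    (a₁ a₂ c₁ c₂ : ℤ)
    (ha₁ : ¬ (p : ℤ) ∣ a₁) (ha₂ : ¬ (p : ℤ) ∣ a₂)
    (hc₁ : ¬ (p : ℤ) ∣ c₁) (hc₂ : ¬ (p : ℤ) ∣ c₂)
    (α₁ α₂ γ₁ γ₂ : ℕ) (h₁ : α₁ + γ₁ < n) (h₂ : α₂ + γ₂ < n)
    (hcong1 : (p : ℤ) ^ (α₁ + γ₁) * (a₁ * c₁) ≡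
      3 * ((p : ℤ) ^ (α₂ + γ₂) * (a₂ * c₂)) [ZMOD (p : ℤ) ^ n])
    (hcong2 : 3 * ((p : ℤ) ^ (α₂ + γ₂) * (a₂ * c₂)) ≡
      -((p : ℤ) ^ (α₁ + γ₂) * (a₁ * c₂) + (p : ℤ) ^ (α₂ + γ₁) * (a₂ * c₁))
        [ZMOD (p : ℤ) ^ n]) :
    p % 3 = 1 := by
  have : Fact p.Prime := ⟨hp⟩
  have hpZ : Prime (p : ℤ) := Nat.prime_iff_prime_int.mp hp
  have hp0 : (p : ℤ) ≠ 0 := hpZ.ne_zero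
  have h3 : ¬ (p : ℤ) ∣ 3 := fun h ↦
    hp3 ((Nat.prime_dvd_prime_iff_eq hp Nat.prime_three).mp (by exact_mod_cast h))
  rw [mul_left_comm 3] at hcong1 hcong2
  have hle : α₂ + γ₂ ≤ α₁ + γ₁ :=
    exponent_le_of_pow_mul_modEq hp0 (hpZ.not_dvd_mul ha₁ hc₁) h₁ hcong1
  have hge : α₁ + γ₁ ≤ α₂ + γ₂ :=
    exponent_le_of_pow_mul_modEq hp0 (hpZ.not_dvd_mul h3 (hpZ.not_dvd_mul ha₂ hc₂)) h₂
      hcong1.symm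
  have hsum : (p : ℤ) ^ (α₁ + γ₂) * (a₁ * c₂) + (p : ℤ) ^ (α₂ + γ₁) * (a₂ * c₁) ≡
      (p : ℤ) ^ (α₂ + γ₂) * -(3 * (a₂ * c₂)) [ZMOD (p : ℤ) ^ n] := by
    have h := hcong2.symm.neg
    rwa [neg_neg, ← mul_neg] at h
  have hα : α₁ = α₂ := by
    rcases lt_trichotomy α₁ α₂ with hlt | heq | hgt
    · have := exponent_le_of_add_modEq hp0 (hpZ.not_dvd_mul ha₁ hc₂)
        (by omega) (by omega) hsum
      omega
    · exact heq
    · rw [add_comm ((p : ℤ) ^ (α₁ + γ₂) * _)] at hsum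
      have := exponent_le_of_add_modEq hp0 (hpZ.not_dvd_mul ha₂ hc₁)
        (by omega) (by omega) hsum
      omega
  obtain rfl : γ₁ = γ₂ := by omega
  subst hα
  rw [← mul_add] at hsum
  have e₁ := (ZMod.intCast_eq_intCast_iff _ _ p).mpr (modEq_of_pow_mul_modEq hp0 h₁ hcong1)
  have e₂ := (ZMod.intCast_eq_intCast_iff _ _ p).mpr (modEq_of_pow_mul_modEq hp0 h₁ hsum)
  push_cast at e₁ e₂
  have ha : (a₂ : ZMod p) ≠ 0 := by rwa [Ne, ZMod.intCast_zmod_eq_zero_iff_dvd]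
  have hc : (c₂ : ZMod p) ≠ 0 := by rwa [Ne, ZMod.intCast_zmod_eq_zero_iff_dvd]
  refine mod_three_eq_one_of_root hp3 ((a₁ : ZMod p) / a₂ + 1) ?_
  field_simp
  rw [mul_zero]
  refine (mul_eq_zero.mp (?_ : (c₂ : ZMod p) * _ = 0)).resolve_left hc
  linear_combination (a₁ : ZMod p) * e₂ - (a₂ : ZMod p) * e₁
end

section
/- Let p be a prime and α ≥ 1 an integer. Let a₁, a₂, a₃, c₁, c₂, c₃ be integers coprime to p, let β₁, β₂, β₃, γ₁, γ₂, γ₃ be nonnegative integers, and set b_i := p^{β_i}·a_i and d_i := p^{γ_i}·c_i. Let n₁, n₂ be nonnegative integers, each of which is either zero or coprime to p. Assume: p^α divides b₁d₁, p^α divides b₂d₂, p^α divides b₁d₂ + b₂d₁, p^α divides b₁d₃ + b₃d₁, p^α divides b₂d₃ + b₃d₂, and p^α divides d₃ + n₁d₁ + n₂d₂. Then p^α divides b₃d₃. -/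
/-- Valuation lemma in the proof of vanishing of `H³`: the orthogonality relations force
`p^α ∣ b₃ d₃`. -/
theorem stmt15 (p : ℕ) (hp : p.Prime) (α : ℕ) (hα : 1 ≤ α)
    (a₁ a₂ a₃ c₁ c₂ c₃ : ℤ)
    (ha₁ : ¬ (p : ℤ) ∣ a₁) (ha₂ : ¬ (p : ℤ) ∣ a₂) (ha₃ : ¬ (p : ℤ) ∣ a₃)
    (hc₁ : ¬ (p : ℤ) ∣ c₁) (hc₂ : ¬ (p : ℤ) ∣ c₂) (hc₃ : ¬ (p : ℤ) ∣ c₃)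
    (β₁ β₂ β₃ γ₁ γ₂ γ₃ : ℕ)
    (b₁ b₂ b₃ d₁ d₂ d₃ : ℤ)
    (hb₁ : b₁ = (p : ℤ) ^ β₁ * a₁) (hb₂ : b₂ = (p : ℤ) ^ β₂ * a₂)
    (hb₃ : b₃ = (p : ℤ) ^ β₃ * a₃)
    (hd₁ : d₁ = (p : ℤ) ^ γ₁ * c₁) (hd₂ : d₂ = (p : ℤ) ^ γ₂ * c₂)
    (hd₃ : d₃ = (p : ℤ) ^ γ₃ * c₃)
    (n₁ n₂ : ℕ)
    (hn₁ : n₁ = 0 ∨ ¬ (p : ℤ) ∣ (n₁ : ℤ)) (hn₂ : n₂ = 0 ∨ ¬ (p : ℤ) ∣ (n₂ : ℤ))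
    (H1 : ((p : ℤ) ^ α) ∣ (b₁ * d₁)) (H2 : ((p : ℤ) ^ α) ∣ (b₂ * d₂))
    (H3 : ((p : ℤ) ^ α) ∣ (b₁ * d₂ + b₂ * d₁)) (H4 : ((p : ℤ) ^ α) ∣ (b₁ * d₃ + b₃ * d₁))
    (H5 : ((p : ℤ) ^ α) ∣ (b₂ * d₃ + b₃ * d₂))
    (H6 : ((p : ℤ) ^ α) ∣ (d₃ + (n₁ : ℤ) * d₁ + (n₂ : ℤ) * d₂)) :
    ((p : ℤ) ^ α) ∣ (b₃ * d₃) := by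
  obtain ⟨k₁, h₁⟩ := H1
  obtain ⟨k₂, h₂⟩ := H2
  obtain ⟨k₃, h₃⟩ := H3
  obtain ⟨k₄, h₄⟩ := H4
  obtain ⟨k₅, h₅⟩ := H5
  obtain ⟨k₆, h₆⟩ := H6
  refine ⟨(b₃ + n₁ * b₁ + n₂ * b₂) * k₆ - n₁ * k₄ - n₂ * k₅ - n₁ ^ 2 * k₁ - n₁ * n₂ * k₃
    - n₂ ^ 2 * k₂, ?_⟩
  linear_combination (b₃ + n₁ * b₁ + n₂ * b₂) * h₆ - n₁ * h₄ - n₂ * h₅ - n₁ ^ 2 * h₁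
    - n₁ * n₂ * h₃ - n₂ ^ 2 * h₂
end
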